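/- arXiv:1507.03058 — 3 statements merged into one kernel-verified Lean document; each statement's English description precedes it below -/
import Mathlib

section
/- Let σ be a primitive, non-erasing, well-marked substitution over 𝔸 = {a,b} whose fixed point ξ is recurrent and not ultimately periodic, with A·B ≠ B·A and W_0, δ_a, δ_b, T as in the context. For a letter c let δ_c denote δ_a if c = a and δ_b if c = b. Then: (i) for all letters c, d and every word W, if cWd is a factor of ξ then δ_c·T(W)·d is a factor of ξ; and (ii) there exists L ∈ ℕ such that for all letters c, d and every word W with |T(W)| ≥ L, if δ_c·T(W)·d is a factor of ξ then cWd is a factor of ξ. -/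
namespace Subst

/-- `pow A m` is the `m`-fold concatenation `A^m`. -/
def pow (A : List Bool) : ℕ → List Bool
  | 0 => []
  | n + 1 => pow A n ++ A

/-- Membership in the submonoid of `𝔸*` generated by `{A, B}`. -/
inductive GenAB (A B : List Bool) : List Bool → Prop
  | nil : GenAB A B []
  | appA : ∀ {W}, GenAB A B W → GenAB A B (W ++ A)
  | appB : ∀ {W}, GenAB A B W → GenAB A B (W ++ B)

/-- The extension of a substitution `σ : 𝔸 → 𝔸*` to a monoid morphism of `𝔸*`. -/
def subst (σ : Bool → List Bool) : List Bool → List Bool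
  | [] => []
  | c :: w => σ c ++ subst σ w

/-- The factor `ξ[i, i+n)` of the infinite sequence `ξ`. -/
def wordAt (ξ : ℕ → Bool) (i n : ℕ) : List Bool :=
  (List.range n).map fun k => ξ (i + k)

/-- `W` is a factor of the infinite sequence `ξ`. -/
def IsFactor (ξ : ℕ → Bool) (W : List Bool) : Prop :=
  ∃ i, W = wordAt ξ i W.length

/-- `ξ` is a fixed point of `σ`: for every `n`, `σ(ξ[0,n))` is a prefix of `ξ`. -/
def IsFixedPoint (σ : Bool → List Bool) (ξ : ℕ → Bool) : Prop :=
  ∀ n, subst σ (wordAt ξ 0 n) = wordAt ξ 0 (subst σ (wordAt ξ 0 n)).length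

/-- `ξ` is recurrent: every factor occurs at infinitely many positions. -/
def Recurrent (ξ : ℕ → Bool) : Prop :=
  ∀ W, IsFactor ξ W → ∀ N, ∃ i, N ≤ i ∧ W = wordAt ξ i W.length

/-- `ξ` is ultimately periodic. -/
def UltPeriodic (ξ : ℕ → Bool) : Prop :=
  ∃ p, 1 ≤ p ∧ ∃ N, ∀ n, N ≤ n → ξ (n + p) = ξ n

/-- `σ` is non-erasing: the image of each letter is nonempty. -/
def NonErasing (σ : Bool → List Bool) : Prop := ∀ c, σ c ≠ []

/-- `σ` is well-marked: `σ(c)` begins with the letter `c` for each letter `c`. -/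
def WellMarked (σ : Bool → List Bool) : Prop := ∀ c, ∃ t, σ c = c :: t

/-- `σ` is primitive: for some `n ≥ 1`, each letter occurs in `σⁿ(d)` for each letter `d`. -/
def Primitive (σ : Bool → List Bool) : Prop :=
  ∃ n, 1 ≤ n ∧ ∀ c d : Bool, c ∈ (subst σ)^[n] [d]

/-- `W` is a right special factor of `ξ`: both `Wa` and `Wb` are factors of `ξ`. -/
def RightSpecial (ξ : ℕ → Bool) (W : List Bool) : Prop :=
  ∀ c : Bool, IsFactor ξ (W ++ [c])

/-- `W` is a left special factor of `ξ`: both `aW` and `bW` are factors of `ξ`. -/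
def LeftSpecial (ξ : ℕ → Bool) (W : List Bool) : Prop :=
  ∀ c : Bool, IsFactor ξ (c :: W)

/-- A right special factor is strong if all of `aWa, aWb, bWa, bWb` are factors. -/
def StrongSpecial (ξ : ℕ → Bool) (W : List Bool) : Prop :=
  ∀ c d : Bool, IsFactor ξ (c :: (W ++ [d]))

/-- A right special factor is weak if neither `aW` nor `bW` is right special. -/
def WeakSpecial (ξ : ℕ → Bool) (W : List Bool) : Prop :=
  RightSpecial ξ W ∧ ∀ c : Bool, ¬ RightSpecial ξ (c :: W)

/-- The operator `T(W) = W₀ · σ(W)`. -/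
def T (σ : Bool → List Bool) (W0 W : List Bool) : List Bool := W0 ++ subst σ W

/-- Specification of the word `W₀` (the longest common suffix of `A^∞` and `B^∞`)
together with the distinct letters `δ_a, δ_b`:  `δ_c · W₀` is a suffix of some power
of `σ(c)` for each letter `c`, and `δ_a ≠ δ_b`. -/
def W0Spec (σ : Bool → List Bool) (W0 : List Bool) (δ : Bool → Bool) : Prop :=
  δ false ≠ δ true ∧ ∀ c, ∃ m, 1 ≤ m ∧ (δ c :: W0) <:+ pow (σ c) m

/-- The incidence matrix of `σ`: its columns are the Parikh vectors of `σ(a)` and `σ(b)`. -/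
def incMat (σ : Bool → List Bool) : Matrix Bool Bool ℤ :=
  Matrix.of fun c d => ((σ d).count c : ℤ)

end Subst

namespace Subst

section Words

variable {σ : Bool → List Bool} {ξ : ℕ → Bool}

theorem subst_append (σ : Bool → List Bool) (u v : List Bool) :
    subst σ (u ++ v) = subst σ u ++ subst σ v := by
  induction u with
  | nil => rfl
  | cons c u ih => simp [subst, ih]

theorem subst_singleton (σ : Bool → List Bool) (c : Bool) : subst σ [c] = σ c := by
  simp [subst]

theorem subst_iterate_append (σ : Bool → List Bool) (k : ℕ) (u v : List Bool) :
    (subst σ)^[k] (u ++ v) = (subst σ)^[k] u ++ (subst σ)^[k] v := by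
  induction k generalizing u v with
  | zero => rfl
  | succ k ih => simp [Function.iterate_succ_apply, subst_append, ih]

theorem subst_iterate_eq (σ : Bool → List Bool) (k : ℕ) (u : List Bool) :
    (subst σ)^[k] u = subst (fun c => (subst σ)^[k] [c]) u := by
  induction u with
  | nil =>
    induction k with
    | zero => rfl
    | succ k ih => simpa [Function.iterate_succ_apply, subst] using ih
  | cons c u ih =>
    rw [← List.singleton_append, subst_iterate_append, ih]
    rfl

theorem NonErasing.length_pos (hne : NonErasing σ) (c : Bool) : 0 < (σ c).length :=
  List.length_pos_iff.2 (hne c)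

theorem NonErasing.subst_iterate (hne : NonErasing σ) (k : ℕ) :
    NonErasing (fun c => (subst σ)^[k] [c]) := by
  have key : ∀ u : List Bool, u ≠ [] → (subst σ)^[k] u ≠ [] := by
    induction k with
    | zero => intro u hu; simpa using hu
    | succ k ih =>
      intro u hu
      rw [Function.iterate_succ_apply]
      apply ih
      cases u with
      | nil => exact absurd rfl hu
      | cons c u => simp [subst, hne c]
  exact fun c => key [c] (by simp)

theorem length_wordAt (ξ : ℕ → Bool) (i n : ℕ) : (wordAt ξ i n).length = n := by
  simp [wordAt]

theorem wordAt_add (ξ : ℕ → Bool) (i m n : ℕ) :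
    wordAt ξ i (m + n) = wordAt ξ i m ++ wordAt ξ (i + m) n := by
  simp [wordAt, List.range_add, Function.comp_def, add_assoc]

theorem wordAt_one (ξ : ℕ → Bool) (i : ℕ) : wordAt ξ i 1 = [ξ i] := by
  simp [wordAt]

theorem wordAt_eq_iff {i j n : ℕ} :
    wordAt ξ i n = wordAt ξ j n ↔ ∀ t < n, ξ (i + t) = ξ (j + t) := by
  simp [wordAt]

theorem eq_wordAt_of_wordAt_eq_append {i n : ℕ} {u v : List Bool} (h : wordAt ξ i n = u ++ v) :
    u = wordAt ξ i u.length ∧ v = wordAt ξ (i + u.length) v.length := by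
  have hn : n = u.length + v.length := by
    have := congrArg List.length h
    simpa [length_wordAt] using this
  rw [hn, wordAt_add] at h
  have := List.append_inj h (length_wordAt _ _ _)
  exact ⟨this.1.symm, this.2.symm⟩

theorem IsFactor.of_isSuffix {n : ℕ} {u : List Bool} (h : u <:+ wordAt ξ 0 n) : IsFactor ξ u := by
  obtain ⟨v, hv⟩ := h
  exact ⟨_, (eq_wordAt_of_wordAt_eq_append hv.symm).2⟩

theorem IsFactor.of_isPrefix {u v : List Bool} (h : u <+: v) (hv : IsFactor ξ v) :
    IsFactor ξ u := by
  obtain ⟨w, rfl⟩ := h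
  obtain ⟨i, hi⟩ := hv
  exact ⟨i, (eq_wordAt_of_wordAt_eq_append hi.symm).1⟩

end Words

section Suffix

variable {σ : Bool → List Bool} {W0 : List Bool} {δ : Bool → Bool}

theorem W0Spec.injective (h : W0Spec σ W0 δ) : Function.Injective δ := by
  have h1 := h.1
  intro c d hcd
  cases c <;> cases d <;> simp_all

theorem W0Spec.isSuffix_append (hne : NonErasing σ) (h : W0Spec σ W0 δ) (c : Bool) :
    δ c :: W0 <:+ W0 ++ σ c := by
  obtain ⟨m, hm, hs⟩ := h.2 c
  have pow_comm : ∀ n, σ c ++ pow (σ c) n = pow (σ c) (n + 1) := by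
    intro n
    induction n with
    | zero => simp [pow]
    | succ n ih => rw [pow, ← List.append_assoc, ih]; rfl
  have h1 : δ c :: W0 <:+ pow (σ c) (m + 1) := by
    rw [← pow_comm]
    exact hs.trans (List.suffix_append _ _)
  have h2 : W0 ++ σ c <:+ pow (σ c) (m + 1) := by
    obtain ⟨t, ht⟩ := (List.suffix_cons _ _).trans hs
    exact ⟨t, by rw [pow, ← ht, List.append_assoc]⟩
  refine List.suffix_of_suffix_length_le h1 h2 ?_
  have := hne.length_pos c
  simp only [List.length_cons, List.length_append]
  omega

theorem W0Spec.isSuffix_T (hne : NonErasing σ) (h : W0Spec σ W0 δ) (U : List Bool) :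
    W0 <:+ T σ W0 U := by
  induction U using List.reverseRecOn with
  | nil => simp [T, subst]
  | append_singleton U c ih =>
    have h1 := (List.suffix_cons _ _).trans (h.isSuffix_append hne c)
    obtain ⟨t, ht⟩ := ih
    refine h1.trans ⟨t, ?_⟩
    rw [T, subst_append, subst_singleton, ← List.append_assoc, ← List.append_assoc, ht]
    rfl

theorem W0Spec.cons_isSuffix_T (hne : NonErasing σ) (h : W0Spec σ W0 δ) (U : List Bool)
    (c : Bool) : δ c :: W0 <:+ T σ W0 (U ++ [c]) := by
  obtain ⟨t, ht⟩ := h.isSuffix_T hne U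
  refine (h.isSuffix_append hne c).trans ⟨t, ?_⟩
  rw [T, subst_append, subst_singleton, ← List.append_assoc, ← List.append_assoc, ht]
  rfl

theorem W0Spec.cons_isSuffix_subst (hne : NonErasing σ) (h : W0Spec σ W0 δ) (U : List Bool)
    (c : Bool) (hl : W0.length < (subst σ (U ++ [c])).length) :
    δ c :: W0 <:+ subst σ (U ++ [c]) :=
  List.suffix_of_suffix_length_le (h.cons_isSuffix_T hne U c) (List.suffix_append _ _) hl

theorem W0Spec.letter_eq (h : W0Spec σ W0 δ) {c d : Bool} {V : List Bool}
    (hc : δ c :: W0 <:+ V) (hd : δ d :: W0 <:+ V) : c = d := by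
  have hs := (List.suffix_of_suffix_length_le hc hd (by simp)).eq_of_length (by simp)
  exact h.injective (List.cons.inj hs).1

/-- Unique desubstitution to the left of a cutting point. -/
theorem W0Spec.isSuffix_of_cons_T_isSuffix (hne : NonErasing σ) (h : W0Spec σ W0 δ) (c : Bool)
    (U V : List Bool) (hs : δ c :: T σ W0 U <:+ subst σ V) : c :: U <:+ V := by
  induction U using List.reverseRecOn generalizing V with
  | nil =>
    have hs' : δ c :: W0 <:+ subst σ V := by simpa [T, subst] using hs
    rcases List.eq_nil_or_concat' V with rfl | ⟨V, y, rfl⟩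
    · simp [subst] at hs'
    · have := h.letter_eq hs' (h.cons_isSuffix_subst hne V y (by simpa using hs'.length_le))
      subst this
      exact ⟨V, rfl⟩
  | append_singleton U x ih =>
    rcases List.eq_nil_or_concat' V with rfl | ⟨V, y, rfl⟩
    · simp [subst] at hs
    · have hx : δ x :: W0 <:+ subst σ (V ++ [y]) :=
        (h.cons_isSuffix_T hne U x).trans ((List.suffix_cons _ _).trans hs)
      have := h.letter_eq hx (h.cons_isSuffix_subst hne V y (by simpa using hx.length_le))
      subst this
      have hs' : δ c :: T σ W0 U <:+ subst σ V := by
        obtain ⟨t, ht⟩ := hs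
        refine ⟨t, List.append_cancel_right (bs := σ x) ?_⟩
        simpa [T, subst_append, subst_singleton] using ht
      obtain ⟨t, ht⟩ := ih V hs'
      exact ⟨t, by simp [← ht]⟩

end Suffix

section FixedPoint

variable {σ : Bool → List Bool} {ξ : ℕ → Bool}

/-- The `n`-th cutting point of `ξ` with respect to `σ`. -/
def cutPoint (σ : Bool → List Bool) (ξ : ℕ → Bool) (n : ℕ) : ℕ :=
  (subst σ (wordAt ξ 0 n)).length

theorem cutPoint_zero : cutPoint σ ξ 0 = 0 := by
  simp [cutPoint, wordAt, subst]

theorem subst_wordAt_succ (σ : Bool → List Bool) (ξ : ℕ → Bool) (n : ℕ) :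
    subst σ (wordAt ξ 0 (n + 1)) = subst σ (wordAt ξ 0 n) ++ σ (ξ n) := by
  rw [wordAt_add, subst_append, wordAt_one, subst_singleton, zero_add]

theorem cutPoint_succ (n : ℕ) :
    cutPoint σ ξ (n + 1) = cutPoint σ ξ n + (σ (ξ n)).length := by
  rw [cutPoint, subst_wordAt_succ, List.length_append, cutPoint]

theorem IsFixedPoint.wordAt_cutPoint (hfix : IsFixedPoint σ ξ) (n : ℕ) :
    wordAt ξ (cutPoint σ ξ n) (σ (ξ n)).length = σ (ξ n) := by
  have h := (hfix (n + 1)).symm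
  rw [subst_wordAt_succ] at h
  have := (eq_wordAt_of_wordAt_eq_append h).2
  rw [zero_add] at this
  exact this.symm

theorem exists_cutPoint_le_lt (hne : NonErasing σ) (j : ℕ) :
    ∃ n, cutPoint σ ξ n ≤ j ∧ j < cutPoint σ ξ (n + 1) := by
  induction j with
  | zero =>
    refine ⟨0, by rw [cutPoint_zero], ?_⟩
    rw [cutPoint_succ]
    have := hne.length_pos (ξ 0)
    omega
  | succ j ih =>
    obtain ⟨n, h1, h2⟩ := ih
    rcases Nat.lt_or_ge (j + 1) (cutPoint σ ξ (n + 1)) with h | h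
    · exact ⟨n, by omega, h⟩
    · refine ⟨n + 1, h, ?_⟩
      rw [cutPoint_succ (n + 1)]
      have := hne.length_pos (ξ (n + 1))
      omega

theorem IsFixedPoint.subst_iterate (hfix : IsFixedPoint σ ξ) (k : ℕ) :
    IsFixedPoint (fun c => (subst σ)^[k] [c]) ξ := by
  intro n
  rw [← subst_iterate_eq]
  induction k with
  | zero => simp [length_wordAt]
  | succ k ih =>
    rw [Function.iterate_succ_apply', ih]
    exact hfix _

/-- The largest length of the image of a letter. -/
def maxLength (σ : Bool → List Bool) : ℕ := max (σ false).length (σ true).length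

theorem length_le_maxLength (σ : Bool → List Bool) (c : Bool) :
    (σ c).length ≤ maxLength σ := by
  cases c
  · exact le_max_left _ _
  · exact le_max_right _ _

theorem Primitive.exists_wordAt_infix (hprim : Primitive σ) (hfix : IsFixedPoint σ ξ)
    (n : ℕ) : ∃ k, ∀ c, wordAt ξ 0 n <:+: (subst σ)^[k] [c] := by
  obtain ⟨m, -, hm⟩ := hprim
  set τ : Bool → List Bool := fun c => (subst σ)^[m] [c]
  have h2 : ∀ c, 2 ≤ (τ c).length := by
    intro c
    have h : false ∈ τ c := hm false c
    have h' : true ∈ τ c := hm true c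
    match τ c, h, h' with
    | [x], h, h' => cases x <;> simp at h h'
    | _ :: _ :: _, _, _ => simp
  have hlen : ∀ u : List Bool, 2 * u.length ≤ (subst τ u).length := by
    intro u
    induction u with
    | nil => simp [subst]
    | cons c u ih =>
      have := h2 c
      simp only [subst, List.length_append, List.length_cons]
      omega
  have hgrow : ∀ k c, k < ((subst τ)^[k] [c]).length := by
    intro k c
    induction k with
    | zero => simp
    | succ k ih =>
      rw [Function.iterate_succ_apply']
      have := hlen ((subst τ)^[k] [c])
      omega
  have hpre : wordAt ξ 0 n <+: (subst τ)^[n] [ξ 0] := by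
    have h := (hfix.subst_iterate m).subst_iterate n 1
    rw [← subst_iterate_eq, wordAt_one] at h
    change (subst τ)^[n] [ξ 0] = wordAt ξ 0 ((subst τ)^[n] [ξ 0]).length at h
    rw [h]
    obtain ⟨r, hr⟩ := Nat.exists_eq_add_of_lt (hgrow n (ξ 0))
    rw [hr, add_assoc, wordAt_add]
    exact List.prefix_append _ _
  have hiter : ∀ k u, (subst τ)^[k] u = (subst σ)^[m * k] u := by
    intro k u
    rw [Function.iterate_mul]
    congr 2
    funext v
    exact (subst_iterate_eq σ m v).symm
  refine ⟨m * (n + 1), fun c => ?_⟩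
  rw [← hiter, Function.iterate_succ_apply, subst_singleton]
  obtain ⟨u, v, huv⟩ := List.append_of_mem (hm (ξ 0) c)
  change τ c = _ at huv
  rw [huv, subst_iterate_append, ← List.singleton_append, subst_iterate_append]
  exact hpre.isInfix.trans ⟨_, _, List.append_assoc _ _ _⟩

/-- In a nonperiodic fixed point of a primitive substitution, a given period can only persist
over a bounded range. -/
theorem exists_period_bound (hne : NonErasing σ) (hprim : Primitive σ)
    (hfix : IsFixedPoint σ ξ) (hnp : ¬ UltPeriodic ξ) (p : ℕ) (hp : 1 ≤ p) :
    ∃ R, ∀ i, ∃ t < R, ξ (i + t + p) ≠ ξ (i + t) := by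
  obtain ⟨n, hn⟩ : ∃ n, ξ (n + p) ≠ ξ n := by
    by_contra! h
    exact hnp ⟨p, hp, 0, fun n _ => h n⟩
  obtain ⟨k, hk⟩ := hprim.exists_wordAt_infix hfix (n + p + 1)
  set τ : Bool → List Bool := fun c => (subst σ)^[k] [c]
  refine ⟨2 * maxLength τ, fun i => ?_⟩
  obtain ⟨m, h1, h2⟩ := exists_cutPoint_le_lt (ξ := ξ) (hne.subst_iterate k) i
  change cutPoint τ ξ m ≤ i at h1
  change i < cutPoint τ ξ (m + 1) at h2
  have h3 : cutPoint τ ξ (m + 1) ≤ i + maxLength τ := by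
    rw [cutPoint_succ]
    have := length_le_maxLength τ (ξ m)
    omega
  have h4 := (hfix.subst_iterate k).wordAt_cutPoint (m + 1)
  change wordAt ξ (cutPoint τ ξ (m + 1)) (τ (ξ (m + 1))).length = τ (ξ (m + 1)) at h4
  obtain ⟨u, v, huv⟩ := hk (ξ (m + 1))
  change _ = τ (ξ (m + 1)) at huv
  have hl := length_le_maxLength τ (ξ (m + 1))
  have hl' := congrArg List.length huv
  simp only [List.length_append, length_wordAt] at hl'
  rw [← huv, List.append_assoc] at h4
  have h5 := (eq_wordAt_of_wordAt_eq_append h4).2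
  have h6 := (eq_wordAt_of_wordAt_eq_append h5.symm).1
  rw [length_wordAt, wordAt_eq_iff] at h6
  have e1 := h6 n (by omega)
  have e2 := h6 (n + p) (by omega)
  rw [zero_add] at e1 e2
  refine ⟨cutPoint τ ξ (m + 1) + u.length + n - i, by omega, ?_⟩
  have e3 : i + (cutPoint τ ξ (m + 1) + u.length + n - i)
      = cutPoint τ ξ (m + 1) + u.length + n := by omega
  rw [e3, add_assoc _ n p, ← e1, ← e2]
  exact hn

theorem exists_uniform_period_bound (hne : NonErasing σ) (hprim : Primitive σ)
    (hfix : IsFixedPoint σ ξ) (hnp : ¬ UltPeriodic ξ) (P : ℕ) :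
    ∃ R, ∀ p, 1 ≤ p → p ≤ P → ∀ i, ∃ t < R, ξ (i + t + p) ≠ ξ (i + t) := by
  induction P with
  | zero => exact ⟨0, fun p h1 h2 => by omega⟩
  | succ P ih =>
    obtain ⟨R, hR⟩ := ih
    obtain ⟨R', hR'⟩ := exists_period_bound hne hprim hfix hnp (P + 1) (by omega)
    refine ⟨max R R', fun p h1 h2 i => ?_⟩
    rcases Nat.lt_or_ge P p with h | h
    · obtain rfl : p = P + 1 := by omega
      obtain ⟨t, ht, hne'⟩ := hR' i
      exact ⟨t, lt_max_of_lt_right ht, hne'⟩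
    · obtain ⟨t, ht, hne'⟩ := hR p h1 h i
      exact ⟨t, lt_max_of_lt_left ht, hne'⟩

end FixedPoint

section Synchronization

variable {σ : Bool → List Bool} {ξ : ℕ → Bool}

/-- The end of the block `σ(c)` starting at position `p`, where `c = ξ p`. -/
def nextCut (σ : Bool → List Bool) (ξ : ℕ → Bool) (p : ℕ) : ℕ := p + (σ (ξ p)).length

/-- The part of `ξ` between `p` and `N` is read as a concatenation of blocks `σ(c)`. -/
def Parses (σ : Bool → List Bool) (ξ : ℕ → Bool) (N p : ℕ) : Prop :=
  ∀ n, (nextCut σ ξ)^[n] p < N →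
    wordAt ξ ((nextCut σ ξ)^[n] p) (σ (ξ ((nextCut σ ξ)^[n] p))).length =
      σ (ξ ((nextCut σ ξ)^[n] p))

theorem Parses.nextCut {N p : ℕ} (h : Parses σ ξ N p) : Parses σ ξ N (nextCut σ ξ p) :=
  fun n => h (n + 1)

theorem Parses.wordAt_eq {N p : ℕ} (h : Parses σ ξ N p) (hp : p < N) :
    wordAt ξ p (σ (ξ p)).length = σ (ξ p) := h 0 hp

/-- Two parsings, starting at `p` and at `q`, share no cutting point up to `N`. -/
def NoCommonCut (σ : Bool → List Bool) (ξ : ℕ → Bool) (N p q : ℕ) : Prop :=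
  ∀ m n, (nextCut σ ξ)^[m] p = (nextCut σ ξ)^[n] q → N < (nextCut σ ξ)^[m] p

/-- Two parsings of `ξ` up to `N` without common cutting point, with `p` a cutting point of the
one that lags behind and `q` the next cutting point of the other one. -/
structure Unsynced (σ : Bool → List Bool) (ξ : ℕ → Bool) (N p q : ℕ) : Prop where
  lt : p < q
  le : q ≤ p + maxLength σ
  parses_left : Parses σ ξ N p
  parses_right : Parses σ ξ N q
  disjoint : NoCommonCut σ ξ N p q

theorem Unsynced.nextCut_ne {N p q : ℕ} (h : Unsynced σ ξ N p q) (hN : p + maxLength σ ≤ N) :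
    nextCut σ ξ p ≠ q := by
  intro he
  have h1 := h.disjoint 1 0 he
  have h2 := length_le_maxLength σ (ξ p)
  simp only [Function.iterate_one, nextCut] at h1
  omega

theorem Unsynced.of_nextCut_lt {N p q : ℕ} (hne : NonErasing σ) (h : Unsynced σ ξ N p q)
    (hlt : nextCut σ ξ p < q) : Unsynced σ ξ N (nextCut σ ξ p) q where
  lt := hlt
  le := by
    have := h.le
    have := hne.length_pos (ξ p)
    simp only [nextCut]
    omega
  parses_left := h.parses_left.nextCut
  parses_right := h.parses_right
  disjoint := fun m n => h.disjoint (m + 1) n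

theorem Unsynced.of_lt_nextCut {N p q : ℕ} (h : Unsynced σ ξ N p q)
    (hlt : q < nextCut σ ξ p) : Unsynced σ ξ N q (nextCut σ ξ p) where
  lt := hlt
  le := by
    have := h.lt
    have := length_le_maxLength σ (ξ p)
    simp only [Subst.nextCut]
    omega
  parses_left := h.parses_right
  parses_right := h.parses_left.nextCut
  disjoint := fun m n he => by
    rw [he]
    exact h.disjoint (n + 1) m he.symm

/-- An unsynchronized pair of parsings is determined by the word between the two fronts. -/
theorem Unsynced.eq_of_wordAt_eq (hne : NonErasing σ) {N l : ℕ} (t : ℕ) {p p' : ℕ}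
    (h : Unsynced σ ξ N p (p + l)) (h' : Unsynced σ ξ N p' (p' + l))
    (hw : ∀ s < l, ξ (p + s) = ξ (p' + s)) (hN : p + t + maxLength σ ≤ N)
    (hN' : p' + t + maxLength σ ≤ N) : ξ (p + t) = ξ (p' + t) := by
  induction t using Nat.strong_induction_on generalizing p p' l with
  | _ t ih =>
  rcases Nat.lt_or_ge t l with htl | htl
  · exact hw t htl
  have hl : 0 < l := by have := h.lt; omega
  have h0 : ξ p = ξ p' := hw 0 hl
  have hpos := hne.length_pos (ξ p)
  have hmax := length_le_maxLength σ (ξ p)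
  have hn : Subst.nextCut σ ξ p = p + (σ (ξ p)).length := rfl
  have hn' : Subst.nextCut σ ξ p' = p' + (σ (ξ p)).length := by rw [h0]; rfl
  have hneq := h.nextCut_ne (by omega)
  rw [hn] at hneq
  rcases Nat.lt_or_ge (σ (ξ p)).length l with ha | ha
  · have k := h.of_nextCut_lt hne (by omega)
    have k' := h'.of_nextCut_lt hne (by omega)
    obtain ⟨r, rfl⟩ := Nat.exists_eq_add_of_lt ha
    obtain ⟨u, hu⟩ := Nat.exists_eq_add_of_le (show (σ (ξ p)).length ≤ t by omega)
    rw [hn, add_assoc, ← add_assoc] at k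
    rw [hn', add_assoc, ← add_assoc] at k'
    have := ih u (by omega) k k' (fun s hs => by
      rw [add_assoc, add_assoc]; exact hw _ (by omega)) (by omega) (by omega)
    rw [hu, ← add_assoc, ← add_assoc]
    exact this
  · obtain ⟨r, hr⟩ := Nat.exists_eq_add_of_le ha
    have k := h.of_lt_nextCut (by omega)
    have k' := h'.of_lt_nextCut (by omega)
    obtain ⟨u, hu⟩ := Nat.exists_eq_add_of_le htl
    rw [hn, hr, ← add_assoc] at k
    rw [hn', hr, ← add_assoc] at k'
    have e := h.parses_left.wordAt_eq (by omega)
    have e' := h'.parses_left.wordAt_eq (by omega)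
    rw [← h0, ← e, length_wordAt, wordAt_eq_iff] at e'
    have := ih u (by omega) k k' (fun s hs => by
      rw [add_assoc, add_assoc]; exact (e' _ (by omega)).symm) (by omega) (by omega)
    rw [hu, ← add_assoc, ← add_assoc]
    exact this

theorem Unsynced.exists_next {N p q : ℕ} (hne : NonErasing σ) (h : Unsynced σ ξ N p q)
    (hN : p + maxLength σ ≤ N) :
    ∃ p' q', Unsynced σ ξ N p' q' ∧ p < p' ∧ p' ≤ p + maxLength σ := by
  have hpos := hne.length_pos (ξ p)
  have hmax := length_le_maxLength σ (ξ p)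
  rcases lt_or_gt_of_ne (h.nextCut_ne hN) with hlt | hlt
  · refine ⟨_, _, h.of_nextCut_lt hne hlt, ?_, ?_⟩ <;> simp only [nextCut] <;> omega
  · exact ⟨_, _, h.of_lt_nextCut hlt, h.lt, h.le⟩

theorem Unsynced.exists_sequence {N p q : ℕ} (hne : NonErasing σ) (h : Unsynced σ ξ N p q)
    (S : ℕ) (hN : p + S * maxLength σ ≤ N) :
    ∃ P Q : ℕ → ℕ, (∀ n ≤ S, Unsynced σ ξ N (P n) (Q n) ∧ p ≤ P n ∧ P n ≤ p + n * maxLength σ) ∧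
      ∀ n m, n < m → m ≤ S → P n < P m := by
  induction S with
  | zero =>
    refine ⟨fun _ => p, fun _ => q, fun n _ => ⟨h, le_rfl, by simp⟩, fun n m _ _ => by omega⟩
  | succ S ih =>
    rw [add_mul, one_mul] at hN
    obtain ⟨P, Q, hPQ, hmono⟩ := ih (by omega)
    obtain ⟨hS, hSge, hSle⟩ := hPQ S le_rfl
    obtain ⟨p', q', h', hlt, hle⟩ := hS.exists_next hne (by omega)
    refine ⟨fun n => if n ≤ S then P n else p', fun n => if n ≤ S then Q n else q', ?_, ?_⟩
    · intro n hn
      by_cases hnS : n ≤ S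
      · simpa [hnS] using hPQ n hnS
      · obtain rfl : n = S + 1 := by omega
        simp only [hnS, if_false, add_mul, one_mul]
        exact ⟨h', by omega, by omega⟩
    · intro n m hnm hm
      have hnS : n ≤ S := by omega
      by_cases hmS : m ≤ S
      · simpa [hnS, hmS] using hmono n m hnm hmS
      · simp only [hnS, hmS, if_true, if_false]
        rcases Nat.lt_or_ge n S with hh | hh
        · exact (hmono n S hh le_rfl).trans hlt
        · obtain rfl : n = S := by omega
          exact hlt

theorem exists_sync_bound (hne : NonErasing σ) (hprim : Primitive σ)
    (hfix : IsFixedPoint σ ξ) (hnp : ¬ UltPeriodic ξ) :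
    ∃ K, ∀ N p q, Unsynced σ ξ N p q → N < p + K := by
  have hfin : Finite {w : List Bool // w.length ≤ maxLength σ} :=
    (List.finite_length_le Bool (maxLength σ)).to_subtype
  set S := Nat.card {w : List Bool // w.length ≤ maxLength σ}
  obtain ⟨R, hR⟩ := exists_uniform_period_bound hne hprim hfix hnp (S * maxLength σ)
  refine ⟨S * maxLength σ + R + maxLength σ, fun N p q h => ?_⟩
  by_contra! hN
  obtain ⟨P, Q, hPQ, hmono⟩ := h.exists_sequence hne S (by omega)
  have hlen : ∀ n : Fin (S + 1),
      (wordAt ξ (P n) (Q n - P n)).length ≤ maxLength σ := fun n => by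
    have := (hPQ n (by omega)).1.le
    rw [length_wordAt]
    omega
  let f : Fin (S + 1) → {w : List Bool // w.length ≤ maxLength σ} :=
    fun n => ⟨wordAt ξ (P n) (Q n - P n), hlen n⟩
  have hf : ¬ Function.Injective f := fun hinj => by
    have := Nat.card_le_card_of_injective f hinj
    rw [Nat.card_fin] at this
    omega
  obtain ⟨i, j, hlt, hij⟩ : ∃ i j : Fin (S + 1), i < j ∧ f i = f j := by
    simp only [Function.Injective, not_forall] at hf
    obtain ⟨i, j, he, hij⟩ := hf
    rcases lt_or_gt_of_ne hij with hh | hh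
    · exact ⟨i, j, hh, he⟩
    · exact ⟨j, i, hh, he.symm⟩
  have hw : wordAt ξ (P i) (Q i - P i) = wordAt ξ (P j) (Q j - P j) := congrArg Subtype.val hij
  have hl : Q i - P i = Q j - P j := by simpa [length_wordAt] using congrArg List.length hw
  obtain ⟨hi, hpi, -⟩ := hPQ i (by omega)
  obtain ⟨hj, -, hjle⟩ := hPQ j (by omega)
  have hPlt : P i < P j := hmono i j hlt (by omega)
  have hjS : (j : ℕ) * maxLength σ ≤ S * maxLength σ := Nat.mul_le_mul_right _ (by omega)
  obtain ⟨t, ht, hne'⟩ := hR (P j - P i) (by omega) (by omega) (P i)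
  apply hne'
  rw [← hl, wordAt_eq_iff] at hw
  have hqi : P i + (Q i - P i) = Q i := Nat.add_sub_of_le hi.lt.le
  have hqj : P j + (Q i - P i) = Q j := by rw [hl]; exact Nat.add_sub_of_le hj.lt.le
  have := Unsynced.eq_of_wordAt_eq hne t (l := Q i - P i) (by rwa [hqi]) (by rwa [hqj]) hw
    (by omega) (by omega)
  rw [this]
  congr 1
  omega

theorem nextCut_cutPoint (hwm : WellMarked σ) (hfix : IsFixedPoint σ ξ) (n : ℕ) :
    ξ (cutPoint σ ξ n) = ξ n ∧ nextCut σ ξ (cutPoint σ ξ n) = cutPoint σ ξ (n + 1) := by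
  have h : ξ (cutPoint σ ξ n) = ξ n := by
    have h1 := hfix.wordAt_cutPoint n
    obtain ⟨t, ht⟩ := hwm (ξ n)
    rw [ht, List.length_cons, add_comm, wordAt_add, wordAt_one] at h1
    exact (List.cons.inj h1).1
  exact ⟨h, by rw [nextCut, h, cutPoint_succ]⟩

theorem iterate_nextCut_cutPoint (hwm : WellMarked σ) (hfix : IsFixedPoint σ ξ) (n k : ℕ) :
    (nextCut σ ξ)^[k] (cutPoint σ ξ n) = cutPoint σ ξ (n + k) := by
  induction k with
  | zero => rfl
  | succ k ih => rw [Function.iterate_succ_apply', ih, (nextCut_cutPoint hwm hfix _).2, add_assoc]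

theorem parses_cutPoint (hwm : WellMarked σ) (hfix : IsFixedPoint σ ξ) (N n : ℕ) :
    Parses σ ξ N (cutPoint σ ξ n) := by
  intro k _
  rw [iterate_nextCut_cutPoint hwm hfix, (nextCut_cutPoint hwm hfix _).1]
  exact hfix.wordAt_cutPoint _

theorem le_iterate_nextCut (p n : ℕ) : p ≤ (nextCut σ ξ)^[n] p := by
  induction n with
  | zero => exact le_rfl
  | succ n ih =>
    rw [Function.iterate_succ_apply']
    exact ih.trans (Nat.le_add_right _ _)

theorem parses_of_subst_eq_wordAt (hwm : WellMarked σ) (W : List Bool) (j : ℕ)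
    (h : subst σ W = wordAt ξ j (subst σ W).length) :
    Parses σ ξ (j + (subst σ W).length) j ∧
      (nextCut σ ξ)^[W.length] j = j + (subst σ W).length := by
  induction W generalizing j with
  | nil =>
    refine ⟨fun n hn => ?_, rfl⟩
    have := le_iterate_nextCut (σ := σ) (ξ := ξ) j n
    simp only [subst, List.length_nil] at hn
    omega
  | cons c W ih =>
    obtain ⟨h1, h2⟩ := eq_wordAt_of_wordAt_eq_append (u := σ c) (v := subst σ W) h.symm
    have hc : ξ j = c := by
      obtain ⟨t, ht⟩ := hwm c
      rw [ht, List.length_cons, add_comm, wordAt_add, wordAt_one] at h1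
      exact (List.cons.inj h1).1.symm
    obtain ⟨k1, k2⟩ := ih _ h2
    have hlen : j + (subst σ (c :: W)).length = j + (σ c).length + (subst σ W).length := by
      simp [subst, add_assoc]
    have hnext : nextCut σ ξ j = j + (σ c).length := by rw [nextCut, hc]
    rw [hlen]
    refine ⟨fun n hn => ?_, ?_⟩
    · cases n with
      | zero => simpa [hc] using h1.symm
      | succ n =>
        rw [Function.iterate_succ_apply, hnext] at hn ⊢
        exact k1 n hn
    · rw [List.length_cons, Function.iterate_succ_apply, hnext, k2]

theorem iterate_nextCut_strictMono (hne : NonErasing σ) (p : ℕ) :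
    StrictMono fun n => (nextCut σ ξ)^[n] p := by
  refine strictMono_nat_of_lt_succ fun n => ?_
  rw [Function.iterate_succ_apply']
  exact Nat.lt_add_of_pos_right (hne.length_pos _)

/-- The end of every long enough occurrence of some `σ(W)` is a cutting point. -/
theorem exists_cutPoint_bound (hne : NonErasing σ) (hwm : WellMarked σ) (hprim : Primitive σ)
    (hfix : IsFixedPoint σ ξ) (hnp : ¬ UltPeriodic ξ) :
    ∃ K, ∀ (W : List Bool) (j : ℕ), K ≤ (subst σ W).length →
      subst σ W = wordAt ξ j (subst σ W).length →
      ∃ n, j + (subst σ W).length = cutPoint σ ξ n := by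
  obtain ⟨K, hK⟩ := exists_sync_bound hne hprim hfix hnp
  refine ⟨K, fun W j hl hW => ?_⟩
  obtain ⟨hpar, hend⟩ := parses_of_subst_eq_wordAt hwm W j hW
  obtain ⟨n, hn1, hn2⟩ := exists_cutPoint_le_lt (ξ := ξ) hne j
  rcases hn1.eq_or_lt with rfl | hlt
  · exact ⟨_, by rw [← hend, iterate_nextCut_cutPoint hwm hfix]⟩
  have hsync : ¬ NoCommonCut σ ξ (j + (subst σ W).length) (cutPoint σ ξ n) j := fun hd => by
    have hle : j ≤ cutPoint σ ξ n + maxLength σ := by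
      rw [cutPoint_succ] at hn2
      have := length_le_maxLength σ (ξ n)
      omega
    have := hK _ _ _ ⟨hlt, hle, parses_cutPoint hwm hfix _ _, hpar, hd⟩
    omega
  simp only [NoCommonCut, not_forall, not_lt] at hsync
  obtain ⟨a, b, hab, hle⟩ := hsync
  rw [hab, ← hend] at hle
  have hb : b ≤ W.length := (iterate_nextCut_strictMono hne j).le_iff_le.1 hle
  obtain ⟨r, hr⟩ := Nat.exists_eq_add_of_le' hb
  refine ⟨n + a + r, ?_⟩
  rw [← hend, hr, Function.iterate_add_apply, ← hab, iterate_nextCut_cutPoint hwm hfix,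
    iterate_nextCut_cutPoint hwm hfix]

end Synchronization

end Subst

open Subst
/-- (i) if `cWd` is a factor of `ξ` then `δ_c·T(W)·d` is a factor of `ξ`;
(ii) there exists `L` such that, conversely, if `|T(W)| ≥ L` and `δ_c·T(W)·d` is a
factor of `ξ` then `cWd` is a factor of `ξ`. -/
theorem statement13 (σ : Bool → List Bool) (hne : NonErasing σ)
    (hwm : WellMarked σ) (hprim : Primitive σ)
    (hAB : σ false ++ σ true ≠ σ true ++ σ false)
    (W0 : List Bool) (δ : Bool → Bool) (hW0 : W0Spec σ W0 δ)
    (ξ : ℕ → Bool) (hfix : IsFixedPoint σ ξ) (hrec : Recurrent ξ)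
    (hnp : ¬ UltPeriodic ξ) :
    (∀ (c d : Bool) (W : List Bool), IsFactor ξ (c :: (W ++ [d])) →
        IsFactor ξ (δ c :: (T σ W0 W ++ [d]))) ∧
    (∃ L : ℕ, ∀ (c d : Bool) (W : List Bool), L ≤ (T σ W0 W).length →
        IsFactor ξ (δ c :: (T σ W0 W ++ [d])) → IsFactor ξ (c :: (W ++ [d]))) := by
  have hlen : ∀ n, n ≤ cutPoint σ ξ n := fun n => by
    induction n with
    | zero => exact Nat.zero_le _
    | succ n ih =>
      rw [cutPoint_succ]
      have := hne.length_pos (ξ n)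
      omega
  constructor
  · intro c d W hW
    obtain ⟨i, hi, hW⟩ := hrec _ hW W0.length
    obtain ⟨n, hn⟩ : ∃ n, (c :: (W ++ [d])).length = n := ⟨_, rfl⟩
    rw [hn] at hW
    have hV : wordAt ξ 0 (i + n) = (wordAt ξ 0 i ++ [c]) ++ W ++ [d] := by
      rw [wordAt_add, zero_add, ← hW]
      simp
    have hc : wordAt ξ 0 (i + 1) = wordAt ξ 0 i ++ [c] := by
      rw [wordAt_add, zero_add, wordAt_one]
      simp only [List.length_cons] at hn
      rw [← hn, add_comm _ 1, wordAt_add, wordAt_one] at hW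
      rw [(List.cons.inj hW).1]
    have hs : δ c :: W0 <:+ subst σ (wordAt ξ 0 i ++ [c]) := by
      refine hW0.cons_isSuffix_subst hne _ _ ?_
      have := hlen (i + 1)
      rw [cutPoint, hc] at this
      omega
    obtain ⟨u, hu⟩ := hs
    obtain ⟨t, ht⟩ := hwm d
    have hσ := hfix (i + n)
    rw [hV, subst_append, subst_append, subst_singleton, ← hu, ht] at hσ
    have hfac : IsFactor ξ (δ c :: (T σ W0 W ++ d :: t)) :=
      IsFactor.of_isSuffix ⟨u, Eq.trans (by simp [T]) hσ⟩
    exact hfac.of_isPrefix ⟨t, by simp⟩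
  · obtain ⟨K, hK⟩ := exists_cutPoint_bound hne hwm hprim hfix hnp
    refine ⟨W0.length + K, fun c d W hL hF => ?_⟩
    obtain ⟨i, hi⟩ := hF
    have hi' : wordAt ξ i (δ c :: (T σ W0 W ++ [d])).length
        = (δ c :: W0) ++ (subst σ W ++ [d]) := by
      rw [← hi]
      simp [T]
    have h1 := (eq_wordAt_of_wordAt_eq_append hi').2
    have h2 := eq_wordAt_of_wordAt_eq_append h1.symm
    simp only [T, List.length_append] at hL
    obtain ⟨n, hn⟩ := hK W _ (by omega) h2.1
    have hd : d = ξ n := by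
      have h3 := h2.2
      rw [hn, List.length_singleton, wordAt_one, (nextCut_cutPoint hwm hfix n).1] at h3
      exact (List.cons.inj h3).1
    have hs : δ c :: T σ W0 W <:+ subst σ (wordAt ξ 0 n) := by
      have h4 : wordAt ξ i (δ c :: (T σ W0 W ++ [d])).length
          = (δ c :: T σ W0 W) ++ [d] := by
        rw [← hi]
        simp
      have h5 := (eq_wordAt_of_wordAt_eq_append h4).1
      have h6 : cutPoint σ ξ n = i + (δ c :: T σ W0 W).length := by
        rw [← hn]
        simp [T]
        omega
      rw [hfix n]
      change _ <:+ wordAt ξ 0 (cutPoint σ ξ n)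
      rw [h6, wordAt_add, zero_add, ← h5]
      exact List.suffix_append _ _
    obtain ⟨t, ht⟩ := hW0.isSuffix_of_cons_T_isSuffix hne c W _ hs
    refine IsFactor.of_isSuffix (n := n + 1) ⟨t, ?_⟩
    rw [wordAt_add, ← ht, wordAt_one, zero_add, hd]
    simp
end

section
/- Let M be a real 2×2 matrix, λ₁ > λ₂ ≥ 0 real numbers, and V₁, V₂ ∈ ℝ² with M·V₁ = λ₁·V₁, M·V₂ = λ₂·V₂, both coordinates of V₁ positive, and V₂ ≠ 0. Then for all X, Y ∈ ℝ² there exists N ∈ ℕ such that the quantity (1,1)·M^{N+n}·(X − Y) has constant sign in n: either it is positive for all n ∈ ℕ, or zero for all n ∈ ℕ, or negative for all n ∈ ℕ. -/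
open Subst

open Filter in
/-- A dominant geometric term with positive coefficient is eventually positive. -/
theorem exists_forall_pow_mul_add_pow_mul_pos {r s p : ℝ} (q : ℝ) (hs : 0 ≤ s) (hsr : s < r)
    (hp : 0 < p) : ∃ N : ℕ, ∀ n : ℕ, 0 < r ^ (N + n) * p + s ^ (N + n) * q := by
  have hr : 0 < r := hs.trans_lt hsr
  have hlim : Tendsto (fun k : ℕ => p + (s / r) ^ k * q) atTop (nhds (p + 0 * q)) :=
    ((tendsto_pow_atTop_nhds_zero_of_lt_one (div_nonneg hs hr.le)
      ((div_lt_one hr).2 hsr)).mul_const q).const_add p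
  obtain ⟨N, hN⟩ := eventually_atTop.1 (hlim.eventually_const_lt (u := 0) (by simpa using hp))
  refine ⟨N, fun n => ?_⟩
  have hpos := mul_pos (pow_pos hr (N + n)) (hN (N + n) (Nat.le_add_right N n))
  have hne : r ^ (N + n) ≠ 0 := (pow_pos hr _).ne'
  rwa [mul_add, div_pow, ← mul_assoc, mul_div_cancel₀ _ hne] at hpos

/-- A combination of two nonnegative geometric sequences has eventually constant sign. -/
theorem exists_pow_mul_add_pow_mul_sign_const {r s : ℝ} (p q : ℝ) (hs : 0 ≤ s) (hsr : s < r) :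
    ∃ N : ℕ,
      (∀ n : ℕ, 0 < r ^ (N + n) * p + s ^ (N + n) * q) ∨
      (∀ n : ℕ, r ^ (N + n) * p + s ^ (N + n) * q = 0) ∨
      (∀ n : ℕ, r ^ (N + n) * p + s ^ (N + n) * q < 0) := by
  rcases lt_trichotomy p 0 with hp | rfl | hp
  · obtain ⟨N, hN⟩ := exists_forall_pow_mul_add_pow_mul_pos (-q) hs hsr (neg_pos.2 hp)
    exact ⟨N, Or.inr (Or.inr fun n => by linarith [hN n])⟩
  · rcases hs.eq_or_lt with rfl | hs
    · exact ⟨1, Or.inr (Or.inl fun n => by simp [add_comm 1 n])⟩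
    · refine ⟨0, ?_⟩
      rcases lt_trichotomy q 0 with hq | rfl | hq
      · exact Or.inr (Or.inr fun n => by
          simpa using mul_neg_of_pos_of_neg (pow_pos hs n) hq)
      · exact Or.inr (Or.inl fun n => by simp)
      · exact Or.inl fun n => by simpa using mul_pos (pow_pos hs n) hq
  · obtain ⟨N, hN⟩ := exists_forall_pow_mul_add_pow_mul_pos q hs hsr hp
    exact ⟨N, Or.inl hN⟩

/-- An eigenvector of `M` is an eigenvector of every power of `M`. -/
theorem Matrix.pow_mulVec_of_mulVec_eq_smul {ι R : Type*} [Fintype ι] [DecidableEq ι]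
    [CommSemiring R] {M : Matrix ι ι R} {c : R} {v : ι → R} (h : M.mulVec v = c • v) (k : ℕ) :
    (M ^ k).mulVec v = c ^ k • v := by
  induction k with
  | zero => simp
  | succ k ih =>
    rw [pow_succ, ← Matrix.mulVec_mulVec, h, Matrix.mulVec_smul, ih, smul_smul, pow_succ']

/-- Two linearly independent vectors span the plane. -/
theorem exists_eq_smul_add_smul_of_linearIndependent {K : Type*} [Field K] {v w : Fin 2 → K}
    (h : LinearIndependent K ![v, w]) (z : Fin 2 → K) : ∃ a b : K, z = a • v + b • w := by
  have hspan := h.span_eq_top_of_card_eq_finrank' (by simp)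
  have hz : z ∈ Submodule.span K (Set.range ![v, w]) := hspan ▸ Submodule.mem_top
  rw [Matrix.range_cons_cons_empty, Submodule.mem_span_pair] at hz
  obtain ⟨a, b, hab⟩ := hz
  exact ⟨a, b, hab.symm⟩

/-- Eigenvectors for two distinct eigenvalues are linearly independent. -/
theorem Matrix.linearIndependent_pair_of_mulVec_eq_smul {ι K : Type*} [Fintype ι] [Field K]
    {M : Matrix ι ι K} {c d : K} {v w : ι → K} (hcd : c ≠ d)
    (hv : M.mulVec v = c • v) (hw : M.mulVec w = d • w) (hv0 : v ≠ 0) (hw0 : w ≠ 0) :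
    LinearIndependent K ![v, w] := by
  refine (LinearIndependent.pair_iff' hv0).2 fun a ha => ?_
  have h : c • w = d • w := by
    rw [← hw, ← ha, Matrix.mulVec_smul, hv, smul_comm]
  exact hcd (smul_left_injective K hw0 h)

/-- Eventual constancy of the sign of `(1,1)·Mᵏ(X − Y)`. -/
theorem statement17 (M : Matrix (Fin 2) (Fin 2) ℝ) (lam1 lam2 : ℝ)
    (V1 V2 : Fin 2 → ℝ)
    (hlt : lam2 < lam1) (h2 : 0 ≤ lam2)
    (hV1 : M.mulVec V1 = lam1 • V1) (hV2 : M.mulVec V2 = lam2 • V2)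
    (hV1pos : ∀ i, 0 < V1 i) (hV2ne : V2 ≠ 0) :
    ∀ X Y : Fin 2 → ℝ, ∃ N : ℕ,
      (∀ n : ℕ, 0 < ∑ i, (M ^ (N + n)).mulVec (X - Y) i) ∨
      (∀ n : ℕ, ∑ i, (M ^ (N + n)).mulVec (X - Y) i = 0) ∨
      (∀ n : ℕ, ∑ i, (M ^ (N + n)).mulVec (X - Y) i < 0) := by
  intro X Y
  have hV1ne : V1 ≠ 0 := fun h => (hV1pos 0).ne' (congrFun h 0)
  obtain ⟨a, b, hab⟩ := exists_eq_smul_add_smul_of_linearIndependent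
    (Matrix.linearIndependent_pair_of_mulVec_eq_smul hlt.ne' hV1 hV2 hV1ne hV2ne) (X - Y)
  have hsum (k : ℕ) : ∑ i, (M ^ k).mulVec (X - Y) i =
      lam1 ^ k * (a * ∑ i, V1 i) + lam2 ^ k * (b * ∑ i, V2 i) := by
    rw [hab, Matrix.mulVec_add, Matrix.mulVec_smul, Matrix.mulVec_smul,
      Matrix.pow_mulVec_of_mulVec_eq_smul hV1, Matrix.pow_mulVec_of_mulVec_eq_smul hV2]
    simp only [Fin.sum_univ_two, Pi.add_apply, Pi.smul_apply, smul_eq_mul]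
    ring
  simp only [hsum]
  exact exists_pow_mul_add_pow_mul_sign_const _ _ h2 hlt
end

section
/- Let σ be a non-erasing substitution over 𝔸 = {a,b} with incidence matrix M, with A·B ≠ B·A and W_0, T as in the context. Then for every word W and every n ∈ ℕ (all identities in ℤ): (i) |σ^{n+2}(W)| = tr(M)·|σ^{n+1}(W)| − det(M)·|σⁿ(W)|; and (ii) |T^{n+2}(W)| = tr(M)·|T^{n+1}(W)| − det(M)·|Tⁿ(W)| + a, where a = |σ(W_0)| − (tr(M) − 1)·|W_0|. -/
open Subst
/-- Letter counts transform under a substitution by the incidence matrix. -/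
theorem Subst.count_subst (σ : Bool → List Bool) (c : Bool) (V : List Bool) :
    (subst σ V).count c
      = (σ false).count c * V.count false + (σ true).count c * V.count true := by
  induction V with
  | nil => simp [subst]
  | cons d V ih => cases d <;> simp [subst, ih] <;> ring

/-- The Cayley–Hamilton identity for the lengths of `V`, `σ(V)` and `σ²(V)`. -/
theorem Subst.length_subst_subst (σ : Bool → List Bool) (V : List Bool) :
    ((subst σ (subst σ V)).length : ℤ)
      = (incMat σ).trace * ((subst σ V).length : ℤ) - (incMat σ).det * (V.length : ℤ) := by
  have hdet : (incMat σ).det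
      = incMat σ false false * incMat σ true true
        - incMat σ false true * incMat σ true false := by
    rw [← Matrix.det_submatrix_equiv_self finTwoEquiv, Matrix.det_fin_two]
    rfl
  rw [hdet]
  simp only [Matrix.trace, Matrix.diag_apply, Fintype.sum_bool, incMat, Matrix.of_apply,
    ← List.count_false_add_count_true, count_subst]
  push_cast
  ring

/-- The substitution distributes over concatenation. -/
theorem Subst.subst_append_s19 (σ : Bool → List Bool) (U V : List Bool) :
    subst σ (U ++ V) = subst σ U ++ subst σ V := by
  induction U with
  | nil => rfl
  | cons c U ih => simp [subst, ih]

/-- Linear recurrences (over ℤ) for `|σⁿ(W)|` and `|Tⁿ(W)|` governed by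
the characteristic polynomial of the incidence matrix `M`. -/
theorem statement19 (σ : Bool → List Bool) (hne : NonErasing σ)
    (hAB : σ false ++ σ true ≠ σ true ++ σ false)
    (W0 : List Bool) (δ : Bool → Bool) (hW0 : W0Spec σ W0 δ)
    (W : List Bool) (n : ℕ) :
    ((((subst σ)^[n + 2] W).length : ℤ)
        = (incMat σ).trace * (((subst σ)^[n + 1] W).length : ℤ)
          - (incMat σ).det * (((subst σ)^[n] W).length : ℤ)) ∧
    ((((T σ W0)^[n + 2] W).length : ℤ)
        = (incMat σ).trace * (((T σ W0)^[n + 1] W).length : ℤ)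
          - (incMat σ).det * (((T σ W0)^[n] W).length : ℤ)
          + (((subst σ W0).length : ℤ) - ((incMat σ).trace - 1) * (W0.length : ℤ))) := by
  constructor
  · simp only [Function.iterate_succ_apply', length_subst_subst]
  · simp only [Function.iterate_succ_apply', T, subst_append_s19, List.length_append, Nat.cast_add,
      length_subst_subst]
    ring
end
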